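/- Let D be a DAG over observed nodes V and latent nodes L, let M be the MAG of D over V, let A ⊆ V, and let M* be the MAG of the induced subgraph D_A over A. For any X, Y ∈ A and Z ⊆ A\{X,Y}, if there is an m-connecting path between X and Y given Z in M*, then there is an m-connecting path between X and Y given Z in the induced subgraph M_A. -/

import Mathlib

open Classical

namespace CG

/-! ### Generic list helpers -/

/-- Consecutive triple on a list. -/
def ListTriple {α : Type} (p : List α) (a b c : α) : Prop :=
  ∃ i : ℕ, p[i]? = some a ∧ p[i+1]? = some b ∧ p[i+2]? = some c

/-- Consecutive pair (an edge) on a list. -/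
def ListEdge {α : Type} (p : List α) (a b : α) : Prop :=
  ∃ i : ℕ, p[i]? = some a ∧ p[i+1]? = some b

/-! ### Mixed graphs (MAGs, PAGs) -/

/-- Edge marks of a mixed graph. -/
inductive Mark : Type
  | tail | arrow | circle
  deriving DecidableEq

/-- A mixed graph over `V`: `mark a b` is the edge mark at `b` on the edge
between `a` and `b` (`none` if there is no edge). -/
structure MixedGraph (V : Type) where
  mark : V → V → Option Mark

namespace MixedGraph

variable {V : Type} (G : MixedGraph V)

def WellFormed : Prop :=
  (∀ a b : V, (G.mark a b).isSome ↔ (G.mark b a).isSome) ∧ ∀ a : V, G.mark a a = none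

def Adj (a b : V) : Prop := (G.mark a b).isSome

/-- Directed edge `a → b`. -/
def DirEdge (a b : V) : Prop := G.mark a b = some Mark.arrow ∧ G.mark b a = some Mark.tail

/-- Bi-directed edge `a ↔ b`. -/
def BiEdge (a b : V) : Prop := G.mark a b = some Mark.arrow ∧ G.mark b a = some Mark.arrow

/-- Edge with circle marks at both ends. -/
def CircleEdge (a b : V) : Prop := G.mark a b = some Mark.circle ∧ G.mark b a = some Mark.circle

def NoCircles : Prop := ∀ a b : V, G.mark a b ≠ some Mark.circle

def StrictAnc : V → V → Prop := Relation.TransGen G.DirEdge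

/-- `a` is an ancestor of `b` (reflexive). -/
def Anc : V → V → Prop := Relation.ReflTransGen G.DirEdge

/-- No directed cycles and no almost-directed cycles. -/
def Ancestral : Prop :=
  (∀ a : V, ¬ G.StrictAnc a a) ∧ ∀ a b : V, G.BiEdge a b → ¬ G.StrictAnc a b

def IsPath (p : List V) : Prop := 2 ≤ p.length ∧ p.Nodup ∧ p.Chain' G.Adj

def IsPathBetween (X Y : V) (p : List V) : Prop :=
  G.IsPath p ∧ p.head? = some X ∧ p.getLast? = some Y

/-- `b` is a collider between `a` and `c` (arrowheads at `b` on both edges). -/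
def Collider (a b c : V) : Prop := G.mark a b = some Mark.arrow ∧ G.mark c b = some Mark.arrow

/-- Every non-endpoint node of `p` is a collider on `p`. -/
def AllColliders (p : List V) : Prop := ∀ a b c : V, ListTriple p a b c → G.Collider a b c

/-- `b` is a definite non-collider between `a` and `c`. -/
def DefNonCollider (a b c : V) : Prop :=
  (G.mark a b = some Mark.tail ∨ G.mark c b = some Mark.tail) ∨
  (G.mark a b = some Mark.circle ∧ G.mark c b = some Mark.circle ∧ ¬ G.Adj a c)

/-- Every non-endpoint node of `p` is a definite collider or definite non-collider. -/
def DefStatusPath (p : List V) : Prop :=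
  ∀ a b c : V, ListTriple p a b c → G.Collider a b c ∨ G.DefNonCollider a b c

/-- The path `p` is into its first node (arrowhead at the first node). -/
def IntoFirst (p : List V) : Prop :=
  ∃ a b : V, p[0]? = some a ∧ p[1]? = some b ∧ G.mark b a = some Mark.arrow

/-- The path `p` is into its last node. -/
def IntoLast (p : List V) : Prop := G.IntoFirst p.reverse

/-- m-connecting path between `X` and `Y` given `Z`. -/
def MConnPath (Z : Set V) (X Y : V) (p : List V) : Prop :=
  G.IsPathBetween X Y p ∧
  ∀ a b c : V, ListTriple p a b c →
    (G.Collider a b c → ∃ z ∈ Z, G.Anc b z) ∧ (¬ G.Collider a b c → b ∉ Z)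

/-- m-separation. -/
def MSep (X Y : V) (Z : Set V) : Prop := ¬ ∃ p : List V, G.MConnPath Z X Y p

/-- Every pair of non-adjacent nodes is m-separated by some set. -/
def Maximal : Prop :=
  ∀ a b : V, a ≠ b → ¬ G.Adj a b → ∃ Z : Set V, a ∉ Z ∧ b ∉ Z ∧ G.MSep a b Z

def IsMAG : Prop := G.WellFormed ∧ G.NoCircles ∧ G.Ancestral ∧ G.Maximal

/-- Markov equivalence: same m-separation relations. -/
def MarkovEq (G₁ G₂ : MixedGraph V) : Prop :=
  ∀ (X Y : V) (Z : Set V), G₁.MSep X Y Z ↔ G₂.MSep X Y Z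

/-- Possibly directed edge step from `a` to `b`: an edge not into `a`. -/
def PossDirStep (a b : V) : Prop := G.Adj a b ∧ G.mark b a ≠ some Mark.arrow

/-- `a` is a possible ancestor of `b`. -/
def PossAnc : V → V → Prop := Relation.ReflTransGen G.PossDirStep

/-- Connected by a circle path (same bucket). -/
def SameBucket : V → V → Prop := Relation.ReflTransGen G.CircleEdge

/-- Bi-directed path in a mixed graph. -/
def BiPath (p : List V) : Prop := 2 ≤ p.length ∧ p.Nodup ∧ p.Chain' G.BiEdge

/-- Induced subgraph over `A` (all nodes kept; edges outside `A` removed). -/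
noncomputable def restrict (A : Set V) : MixedGraph V :=
  ⟨fun a b => if a ∈ A ∧ b ∈ A then G.mark a b else none⟩

end MixedGraph

/-! ### DAGs with latent variables -/

/-- A directed graph over observed nodes `V` and latent nodes `L`. -/
structure LatDAG (V L : Type) where
  edge : V ⊕ L → V ⊕ L → Prop

namespace LatDAG

variable {V L : Type} (D : LatDAG V L)

/-- Acyclic, every latent node is parentless and has exactly two children, both observed. -/
def IsCausalDAG : Prop :=
  (∀ x : V ⊕ L, ¬ Relation.TransGen D.edge x x) ∧
  (∀ (x : V ⊕ L) (l : L), ¬ D.edge x (Sum.inr l)) ∧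
  (∀ l : L, ∃ a b : V, a ≠ b ∧ D.edge (Sum.inr l) (Sum.inl a) ∧ D.edge (Sum.inr l) (Sum.inl b) ∧
    ∀ c : V ⊕ L, D.edge (Sum.inr l) c → c = Sum.inl a ∨ c = Sum.inl b)

def Adj (x y : V ⊕ L) : Prop := D.edge x y ∨ D.edge y x

/-- Ancestor (reflexive). -/
def Anc : V ⊕ L → V ⊕ L → Prop := Relation.ReflTransGen D.edge

def IsPath (p : List (V ⊕ L)) : Prop := 2 ≤ p.length ∧ p.Nodup ∧ p.Chain' D.Adj

def IsPathBetween (x y : V ⊕ L) (p : List (V ⊕ L)) : Prop :=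
  D.IsPath p ∧ p.head? = some x ∧ p.getLast? = some y

/-- The path `p` is into its first node (arrowhead at the first node). -/
def IntoFirst (p : List (V ⊕ L)) : Prop :=
  ∃ a b : V ⊕ L, p[0]? = some a ∧ p[1]? = some b ∧ D.edge b a

def IntoLast (p : List (V ⊕ L)) : Prop := D.IntoFirst p.reverse

/-- Inducing path between observed `X` and `Y` (relative to the latent nodes):
every non-endpoint observed node is a collider on the path and an ancestor of `X` or `Y`. -/
def InducingPath (X Y : V) (p : List (V ⊕ L)) : Prop :=
  D.IsPathBetween (Sum.inl X) (Sum.inl Y) p ∧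
  ∀ a b c : V ⊕ L, ListTriple p a b c → ∀ v : V, b = Sum.inl v →
    (D.edge a b ∧ D.edge c b) ∧ (D.Anc b (Sum.inl X) ∨ D.Anc b (Sum.inl Y))

/-- `a` and `b` are joined by a bi-directed edge, i.e. share a latent parent. -/
def LatentSib (a b : V) : Prop :=
  a ≠ b ∧ ∃ l : L, D.edge (Sum.inr l) (Sum.inl a) ∧ D.edge (Sum.inr l) (Sum.inl b)

/-- Bi-directed path between observed nodes (listing the observed nodes). -/
def BiPath (p : List V) : Prop := 2 ≤ p.length ∧ p.Nodup ∧ p.Chain' D.LatentSib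

/-- Same c-component (reflexive): connected by a bi-directed path. -/
def CConn : V → V → Prop := Relation.ReflTransGen D.LatentSib

/-- Induced subgraph over `A ⊆ V`: keep observed nodes of `A` and the latent nodes
both of whose children are in `A`. -/
def restrict (A : Set V) : LatDAG V L :=
  ⟨fun x y =>
    D.edge x y ∧
    (∀ v : V, x = Sum.inl v → v ∈ A) ∧ (∀ v : V, y = Sum.inl v → v ∈ A) ∧
    (∀ l : L, x = Sum.inr l → ∀ w : V, D.edge (Sum.inr l) (Sum.inl w) → w ∈ A) ∧
    (∀ l : L, y = Sum.inr l → ∀ w : V, D.edge (Sum.inr l) (Sum.inl w) → w ∈ A)⟩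

/-- `F` is a c-forest with root set `R` in `D`. -/
def CForest (F R : Set V) : Prop :=
  R ⊆ F ∧
  (∀ a ∈ F, ∀ b ∈ F, ∀ c ∈ F,
    D.edge (Sum.inl a) (Sum.inl b) → D.edge (Sum.inl a) (Sum.inl c) → b = c) ∧
  R = {a ∈ F | ∀ b ∈ F, ¬ D.edge (Sum.inl a) (Sum.inl b)} ∧
  (∀ a ∈ F, ∀ b ∈ F, Relation.ReflTransGen (fun u w => u ∈ F ∧ w ∈ F ∧ D.LatentSib u w) a b)

end LatDAG

/-- `M` is the MAG of the DAG `D` over the observed nodes. -/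
def IsMAGof {V L : Type} (M : MixedGraph V) (D : LatDAG V L) : Prop :=
  (∀ X Y : V, M.Adj X Y ↔ ∃ p : List (V ⊕ L), D.InducingPath X Y p) ∧
  ∀ X Y : V, M.Adj X Y →
    (M.DirEdge X Y ↔ D.Anc (Sum.inl X) (Sum.inl Y)) ∧
    (M.BiEdge X Y ↔ ¬ D.Anc (Sum.inl X) (Sum.inl Y) ∧ ¬ D.Anc (Sum.inl Y) (Sum.inl X))

/-- The directed edge `A → B` of the MAG `M` is visible: no DAG whose MAG is `M`
has an inducing path between `A` and `B` that is into `A`. -/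
def MagVisible {V : Type} (M : MixedGraph V) (A B : V) : Prop :=
  M.DirEdge A B ∧
  ∀ (L : Type) (D : LatDAG V L), D.IsCausalDAG → IsMAGof M D →
    ¬ ∃ p : List (V ⊕ L), D.InducingPath A B p ∧ D.IntoFirst p

/-- `P` is the PAG of the MAG `M`: same adjacencies, and an arrowhead/tail mark appears
in `P` iff it appears in every Markov equivalent MAG. -/
def IsPAGof {V : Type} (P M : MixedGraph V) : Prop :=
  (∀ a b : V, P.Adj a b ↔ M.Adj a b) ∧
  ∀ a b : V, P.Adj a b →
    ((P.mark a b = some Mark.arrow ↔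
        ∀ M' : MixedGraph V, M'.IsMAG → MixedGraph.MarkovEq M M' →
          M'.mark a b = some Mark.arrow) ∧
     (P.mark a b = some Mark.tail ↔
        ∀ M' : MixedGraph V, M'.IsMAG → MixedGraph.MarkovEq M M' →
          M'.mark a b = some Mark.tail))

/-- The directed edge `A → B` of a PAG `P` is visible: `A → B` in `P` and the edge is
visible in every MAG of the equivalence class represented by `P`. -/
def PagVisible {V : Type} (P : MixedGraph V) (A B : V) : Prop :=
  P.DirEdge A B ∧ ∀ M : MixedGraph V, M.IsMAG → IsPAGof P M → MagVisible M A B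

/-- `X` and `Y` are in the same pc-component of the MAG `M`. -/
def SamePCCompMag {V : Type} (M : MixedGraph V) (X Y : V) : Prop :=
  X = Y ∨ ∃ p : List V, M.IsPathBetween X Y p ∧ M.AllColliders p ∧
    ∀ a b : V, ListEdge p a b → ¬ MagVisible M a b ∧ ¬ MagVisible M b a

/-- `X` and `Y` are in the same pc-component of the PAG `P`. -/
def SamePCCompPag {V : Type} (P : MixedGraph V) (X Y : V) : Prop :=
  X = Y ∨ ∃ p : List V, P.IsPathBetween X Y p ∧ P.AllColliders p ∧
    ∀ a b : V, ListEdge p a b → ¬ PagVisible P a b ∧ ¬ PagVisible P b a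

/-- `D` is a DAG in the Markov equivalence class represented by the PAG `P`. -/
def DagInClass {V L : Type} (P : MixedGraph V) (D : LatDAG V L) : Prop :=
  ∃ M : MixedGraph V, M.IsMAG ∧ IsMAGof M D ∧ IsPAGof P M

/-- `C` is a possible child of `X` in a PAG: they are adjacent, the mark at `X` is not
an arrowhead and the mark at `C` is not a tail. -/
def PossChild {V : Type} (P : MixedGraph V) (X C : V) : Prop :=
  P.Adj X C ∧ P.mark C X ≠ some Mark.arrow ∧ P.mark X C ≠ some Mark.tail

/-- The dc-component of the set `X` in a mixed graph. -/
def DCComp {V : Type} (G : MixedGraph V) (X : Set V) : Set V :=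
  {a | ∃ x ∈ X, Relation.ReflTransGen G.BiEdge x a}

/-- The identification criterion of the theorem: no node `Xi ∈ X` is in the same
pc-component of `P_T` with a possible child `C ∈ T \ X`. -/
def BucketCrit {V : Type} (P : MixedGraph V) (T X : Set V) : Prop :=
  ¬ ∃ Xi ∈ X, ∃ C, C ∈ T ∧ C ∉ X ∧
    PossChild (P.restrict T) Xi C ∧ SamePCCompPag (P.restrict T) Xi C

/-- `B 1 < ... < B m` is a partial topological order over the buckets of `G` covering `T`. -/
def IsBucketTopEnum {V : Type} (G : MixedGraph V) (T : Set V)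
    {m : ℕ} (B : Fin m → Set V) : Prop :=
  (∀ i, (B i).Nonempty) ∧ (∀ i, B i ⊆ T) ∧ (⋃ i, B i) = T ∧
  (∀ i j, i ≠ j → Disjoint (B i) (B j)) ∧
  (∀ i, ∀ a ∈ B i, B i = {b | G.SameBucket a b}) ∧
  (∀ i j, i ≠ j → ∀ a ∈ B i, ∀ b ∈ B j, G.mark a b = some Mark.arrow → i < j)

/-- `B` is a bucket of `G` (with representative in `T`). -/
def IsBucketOf {V : Type} (G : MixedGraph V) (T B : Set V) : Prop :=
  ∃ a ∈ T, B = {b | G.SameBucket a b}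

/-! ### Discrete causal models and c-factors -/

/-- A discrete causal model of a DAG `D`, with observed variables valued in `Ω`. -/
structure CModel {V L : Type} [DecidableEq V] [DecidableEq L]
    (D : LatDAG V L) (Ω : Type) [Fintype Ω] where
  latS : L → Type
  latFin : ∀ l : L, Fintype (latS l)
  latNE : ∀ l : L, Nonempty (latS l)
  cpt : V ⊕ L → (V → Ω) × (∀ l : L, latS l) → ℝ
  cpt_nonneg : ∀ x c, 0 ≤ cpt x c
  cpt_local : ∀ (x : V ⊕ L) (c c' : (V → Ω) × (∀ l : L, latS l)),
    (∀ v : V, (x = Sum.inl v ∨ D.edge (Sum.inl v) x) → c.1 v = c'.1 v) →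
    (∀ l : L, (x = Sum.inr l ∨ D.edge (Sum.inr l) x) → c.2 l = c'.2 l) →
    cpt x c = cpt x c'
  cpt_norm_obs : ∀ (v : V) (c : (V → Ω) × (∀ l : L, latS l)),
    ∑ ω : Ω, cpt (Sum.inl v) (Function.update c.1 v ω, c.2) = 1
  cpt_norm_lat : ∀ (l : L) (c : (V → Ω) × (∀ l : L, latS l)),
    ((@Finset.univ (latS l) (latFin l)).sum
      fun s => cpt (Sum.inr l) (c.1, Function.update c.2 l s)) = 1

/-- The c-factor `Q[T]`, as a function of a full assignment to the observed variables
(the values outside `T` play the role of the intervention values). -/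
noncomputable def CModel.Q {V L : Type} [Fintype V] [DecidableEq V] [Fintype L]
    [DecidableEq L] {D : LatDAG V L} {Ω : Type} [Fintype Ω]
    (M : CModel D Ω) (T : Set V) (c : V → Ω) : ℝ :=
  letI : ∀ l : L, Fintype (M.latS l) := M.latFin
  ∑ g : ∀ l : L, M.latS l,
    (∏ v : V, if v ∈ T then M.cpt (Sum.inl v) (c, g) else 1) *
      ∏ l : L, M.cpt (Sum.inr l) (c, g)

/-- `Q[T \ X]` is identifiable from `Q[T]` in the PAG `P`: a single functional maps
`Q[T]` to `Q[T \ X]` uniformly over every DAG in the class represented by `P`. -/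
def QIdentifiable {V : Type} [Fintype V] [DecidableEq V]
    (P : MixedGraph V) (T X : Set V) : Prop :=
  ∀ (Ω : Type) [Fintype Ω] [Nonempty Ω],
    ∃ F : ((V → Ω) → ℝ) → ((V → Ω) → ℝ),
      ∀ (L : Type) [Fintype L] [DecidableEq L] (D : LatDAG V L),
        D.IsCausalDAG → DagInClass P D →
        ∀ M : CModel D Ω, F (M.Q T) = M.Q (T \ X)

/-- `Q[T \ X]` is identifiable from `Q[T]` in the DAG `D`. -/
def DagIdentifiable {V L : Type} [Fintype V] [DecidableEq V] [Fintype L] [DecidableEq L]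
    (D : LatDAG V L) (T X : Set V) : Prop :=
  ∀ (Ω : Type) [Fintype Ω] [Nonempty Ω],
    ∃ F : ((V → Ω) → ℝ) → ((V → Ω) → ℝ),
      ∀ M : CModel D Ω, F (M.Q T) = M.Q (T \ X)

/-- Probability, under the distribution `q` over the variables of `T` (context fixed
outside `T`), that the variables of `W` take the values given by `c`. -/
noncomputable def MarginProb {V Ω : Type} [Fintype V] [Fintype Ω]
    (T : Set V) (q : (V → Ω) → ℝ) (W : Set V) (c : V → Ω) : ℝ :=
  ∑ d : V → Ω, if (∀ v : V, (v ∈ W ∨ v ∉ T) → d v = c v) then q d else 0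

/-- Conditional term `P_{v\t}(Bi | Prev)` computed from `q = Q[T]`. -/
noncomputable def CondTerm {V Ω : Type} [Fintype V] [Fintype Ω]
    (T : Set V) (q : (V → Ω) → ℝ) (Bi Prev : Set V) (c : V → Ω) : ℝ :=
  MarginProb T q (Bi ∪ Prev) c / MarginProb T q Prev c

/-- Product of the conditional terms of the buckets contained in the dc-component of `X`. -/
noncomputable def BucketDenom {V Ω : Type} [Fintype V] [Fintype Ω]
    (P : MixedGraph V) (T X : Set V) {m : ℕ} (B : Fin m → Set V)
    (q : (V → Ω) → ℝ) (c : V → Ω) : ℝ :=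
  ∏ i ∈ Finset.univ.filter (fun i : Fin m => B i ⊆ DCComp (P.restrict T) X),
    CondTerm T q (B i) {v | ∃ j : Fin m, j < i ∧ v ∈ B j} c

/-- The identification formula: `Q[T\X] = (Q[T] / ∏ P(B_i | B^{(i-1)})) · Σ_x ∏ P(B_i |
B^{(i-1)})`, the product over the buckets of `P_T` inside the dc-component of `X` in a
partial topological order, summed over the values of `X` in the numerator. -/
def BucketFormula {V : Type} [Fintype V] [DecidableEq V]
    (P : MixedGraph V) (T X : Set V) : Prop :=
  ∀ (m : ℕ) (B : Fin m → Set V), IsBucketTopEnum (P.restrict T) T B →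
    ∀ (Ω : Type) [Fintype Ω] [Nonempty Ω] (L : Type) [Fintype L] [DecidableEq L]
      (D : LatDAG V L), D.IsCausalDAG → DagInClass P D →
      ∀ (M : CModel D Ω) (c : V → Ω),
        M.Q (T \ X) c =
          M.Q T c / BucketDenom P T X B (M.Q T) c *
            ∑ d : V → Ω,
              if (∀ v : V, v ∉ X → d v = c v) then BucketDenom P T X B (M.Q T) d else 0

/-- A hedge for `Q[W]` (`W = T \ X`) formed by the intervention set `X`. -/
def IsHedge {V L : Type} (D : LatDAG V L) (W X : Set V) (F F' : Set V) : Prop :=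
  ∃ R : Set V, R ⊆ W ∧ F' ⊆ F ∧ F ⊆ W ∪ X ∧ (F ∩ X).Nonempty ∧ F' ∩ X = ∅ ∧
    D.CForest F R ∧ D.CForest F' R

/-! ### Adjustment, GAC and the IDP algorithm -/

/-- Proper possibly directed path from the set `X` to the set `Y` in a PAG. -/
def ProperPDPath {V : Type} (P : MixedGraph V) (X Y : Set V) (p : List V) : Prop :=
  P.IsPath p ∧ (∃ x ∈ X, p.head? = some x) ∧ (∃ y ∈ Y, p.getLast? = some y) ∧
  (∀ v ∈ p.tail, v ∉ X) ∧ ∀ a b : V, ListEdge p a b → P.mark b a ≠ some Mark.arrow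

/-- `P` is amenable relative to `(X, Y)`: every proper possibly directed path from `X`
to `Y` starts with a visible directed edge out of `X`. -/
def Amenable {V : Type} (P : MixedGraph V) (X Y : Set V) : Prop :=
  ∀ p : List V, ProperPDPath P X Y p →
    ∃ a b : V, p[0]? = some a ∧ p[1]? = some b ∧ PagVisible P a b

/-- The forbidden set: possible descendants of nodes `w ∉ X` lying on proper possibly
directed paths from `X` to `Y`. -/
def Forb {V : Type} (P : MixedGraph V) (X Y : Set V) : Set V :=
  {d | ∃ (w : V) (p : List V), ProperPDPath P X Y p ∧ w ∈ p ∧ w ∉ X ∧ P.PossAnc w d}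

/-- Proper definite status non-causal path from `X` to `Y`. -/
def ProperDefNonCausal {V : Type} (P : MixedGraph V) (X Y : Set V) (p : List V) : Prop :=
  P.IsPath p ∧ P.DefStatusPath p ∧ (∃ x ∈ X, p.head? = some x) ∧
  (∃ y ∈ Y, p.getLast? = some y) ∧ (∀ v ∈ p.tail, v ∉ X) ∧
  ∃ a b : V, ListEdge p a b ∧ P.mark b a = some Mark.arrow

/-- `Z` blocks the definite status path `p`. -/
def BlocksPath {V : Type} (P : MixedGraph V) (Z : Set V) (p : List V) : Prop :=
  (∃ a b c : V, ListTriple p a b c ∧ P.DefNonCollider a b c ∧ b ∈ Z) ∨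
  (∃ a b c : V, ListTriple p a b c ∧ P.Collider a b c ∧ ∀ z ∈ Z, ¬ P.PossAnc b z)

/-- `Z` satisfies the generalized adjustment criterion relative to `(X, Y)` in `P`. -/
def SatGAC {V : Type} (P : MixedGraph V) (X Y Z : Set V) : Prop :=
  Amenable P X Y ∧ Z ∩ Forb P X Y = ∅ ∧
  ∀ p : List V, ProperDefNonCausal P X Y p → BlocksPath P Z p

/-- The canonical adjustment set `Adjust(X, Y, P)`. -/
def AdjustSet {V : Type} (P : MixedGraph V) (X Y : Set V) : Set V :=
  {v | ∃ w ∈ X ∪ Y, P.PossAnc v w} \ (Forb P X Y ∪ X ∪ Y)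

/-- The subroutine `Identify(C, T, Q[T])` of IDP succeeds: it repeatedly removes a
bucket of `P_T` disjoint from `C` satisfying the interventional criterion, until `T = C`. -/
inductive IdentifySucc {V : Type} (P : MixedGraph V) (C : Set V) : Set V → Prop
  | base : IdentifySucc P C C
  | step (T B : Set V) (hBT : B ⊆ T) (hBC : Disjoint B C) (hne : B.Nonempty)
      (hbucket : IsBucketOf (P.restrict T) T B) (hcrit : BucketCrit P T B)
      (h : IdentifySucc P C (T \ B)) : IdentifySucc P C T

/-- The IDP algorithm succeeds on `P_x(y)`: with `D` the set of possible ancestors of `Y`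
in `P_{V \ X}`, every cpc-component of `P_D` is identified by `Identify` from `Q[V]`. -/
def IDPSucc {V : Type} (P : MixedGraph V) (X Y : Set V) : Prop :=
  ∀ a ∈ {d : V | ∃ y ∈ Y, (P.restrict Xᶜ).PossAnc d y},
    IdentifySucc P
      {b : V | b ∈ {d : V | ∃ y ∈ Y, (P.restrict Xᶜ).PossAnc d y} ∧
        Relation.ReflTransGen
          (fun u w =>
            SamePCCompPag (P.restrict {d : V | ∃ y ∈ Y, (P.restrict Xᶜ).PossAnc d y}) u w ∨
            (P.restrict {d : V | ∃ y ∈ Y, (P.restrict Xᶜ).PossAnc d y}).SameBucket u w)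
          a b}
      Set.univ

/-- Definite m-connecting path in a PAG given `Z`. -/
def DefMConnPath {V : Type} (P : MixedGraph V) (Z : Set V) (X Y : V) (p : List V) : Prop :=
  P.IsPathBetween X Y p ∧
  ∀ a b c : V, ListTriple p a b c →
    (P.Collider a b c → ∃ z ∈ Z, P.PossAnc b z) ∧
    (¬ P.Collider a b c → P.DefNonCollider a b c ∧ b ∉ Z)


/-! ### Consecutive triples of lists -/

theorem listTriple_iff_infix {α : Type} {p : List α} {a b c : α} :
    ListTriple p a b c ↔ ∃ s t, p = s ++ a :: b :: c :: t := by
  constructor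
  · rintro ⟨i, ha, hb, hc⟩
    refine ⟨p.take i, p.drop (i + 3), ?_⟩
    obtain ⟨h0, rfl⟩ := List.getElem?_eq_some_iff.1 ha
    obtain ⟨h1, rfl⟩ := List.getElem?_eq_some_iff.1 hb
    obtain ⟨h2, rfl⟩ := List.getElem?_eq_some_iff.1 hc
    rw [← List.drop_eq_getElem_cons h2, ← List.drop_eq_getElem_cons h1,
      ← List.drop_eq_getElem_cons h0, List.take_append_drop]
  · rintro ⟨s, t, rfl⟩
    exact ⟨s.length, by simp, by simp, by simp⟩

theorem ListTriple.reverse {α : Type} {p : List α} {a b c : α}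
    (h : ListTriple p a b c) : ListTriple p.reverse c b a := by
  obtain ⟨s, t, rfl⟩ := listTriple_iff_infix.1 h
  exact listTriple_iff_infix.2 ⟨t.reverse, s.reverse, by simp⟩

theorem ListTriple.of_infix {α : Type} {p q : List α} {a b c : α}
    (h : ListTriple p a b c) (hpq : p <:+: q) : ListTriple q a b c := by
  obtain ⟨s, t, rfl⟩ := listTriple_iff_infix.1 h
  obtain ⟨s', t', rfl⟩ := hpq
  exact listTriple_iff_infix.2 ⟨s' ++ s, t ++ t', by simp⟩

/-- A triple of `s ++ v :: r` lies on one side of `v` or is centred at `v`. -/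
theorem ListTriple.append_cons {α : Type} {s r : List α} {v a b c : α}
    (h : ListTriple (s ++ v :: r) a b c) :
    ListTriple (s ++ [v]) a b c ∨ ListTriple (v :: r) a b c ∨
      (b = v ∧ (∃ s', s = s' ++ [a]) ∧ ∃ r', r = c :: r') := by
  obtain ⟨s₁, t₁, h⟩ := listTriple_iff_infix.1 h
  rcases List.append_eq_append_iff.1 h with ⟨u, rfl, hu⟩ | ⟨u, rfl, hu⟩
  · exact Or.inr (Or.inl (listTriple_iff_infix.2 ⟨u, t₁, hu⟩))
  · match u with
    | [] => exact Or.inr (Or.inl (listTriple_iff_infix.2 ⟨[], t₁, by simpa using hu.symm⟩))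
    | [x] =>
      simp only [List.cons_append, List.nil_append, List.cons.injEq] at hu
      obtain ⟨rfl, rfl, rfl⟩ := hu
      exact Or.inr (Or.inr ⟨rfl, ⟨s₁, rfl⟩, t₁, rfl⟩)
    | [x, y] =>
      simp only [List.cons_append, List.nil_append, List.cons.injEq] at hu
      obtain ⟨rfl, rfl, rfl, rfl⟩ := hu
      exact Or.inl (listTriple_iff_infix.2 ⟨s₁, [], by simp⟩)
    | x :: y :: z :: w =>
      simp only [List.cons_append, List.cons.injEq] at hu
      obtain ⟨rfl, rfl, rfl, rfl⟩ := hu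
      exact Or.inl (listTriple_iff_infix.2 ⟨s₁, w ++ [v], by simp⟩)

/-- A triple arising by cutting out the loop `v :: t ++ [v]` is an old one or is centred at `v`. -/
theorem ListTriple.of_cut {α : Type} {s t r : List α} {v a b c : α}
    (h : ListTriple (s ++ v :: r) a b c) :
    ListTriple (s ++ v :: (t ++ v :: r)) a b c ∨
      (b = v ∧ (∃ x t', t ++ [v] = x :: t' ∧ ListTriple (s ++ v :: (t ++ v :: r)) a v x) ∧
        ∃ y, ListTriple (s ++ v :: (t ++ v :: r)) y v c) := by
  rcases h.append_cons with h | h | ⟨rfl, ⟨s', rfl⟩, r', rfl⟩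
  · exact Or.inl (h.of_infix ⟨[], t ++ v :: r, by simp⟩)
  · exact Or.inl (h.of_infix ⟨s ++ v :: t, [], by simp⟩)
  · refine Or.inr ⟨rfl, ?_, ?_⟩
    · cases t with
      | nil => exact ⟨b, [], rfl, listTriple_iff_infix.2 ⟨s', c :: r', by simp⟩⟩
      | cons x t => exact ⟨x, t ++ [b], rfl, listTriple_iff_infix.2 ⟨s', t ++ b :: c :: r', by simp⟩⟩
    · rcases t.eq_nil_or_concat with rfl | ⟨t', y, rfl⟩
      · exact ⟨b, listTriple_iff_infix.2 ⟨s' ++ [a], r', by simp⟩⟩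
      · exact ⟨y, listTriple_iff_infix.2 ⟨s' ++ a :: b :: t', r', by simp⟩⟩

theorem exists_loop_of_not_nodup {α : Type} {p : List α} (h : ¬ p.Nodup) :
    ∃ s v t r, p = s ++ v :: (t ++ v :: r) := by
  induction p with
  | nil => exact absurd List.nodup_nil h
  | cons a p ih =>
    by_cases ha : a ∈ p
    · obtain ⟨t, r, rfl⟩ := List.append_of_mem ha
      exact ⟨[], a, t, r, rfl⟩
    · obtain ⟨s, v, t, r, rfl⟩ := ih fun hp => h (List.nodup_cons.2 ⟨ha, hp⟩)
      exact ⟨a :: s, v, t, r, rfl⟩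

theorem isChain_cut {α : Type} {R : α → α → Prop} {s t r : List α} {v : α}
    (h : (s ++ v :: (t ++ v :: r)).IsChain R) : (s ++ v :: r).IsChain R := by
  rw [List.isChain_split] at h ⊢
  refine ⟨h.1, ?_⟩
  have h2 := h.2
  rw [← List.cons_append, List.isChain_split] at h2
  exact h2.2

theorem head?_cut {α : Type} (s t r : List α) (v : α) :
    (s ++ v :: r).head? = (s ++ v :: (t ++ v :: r)).head? := by
  cases s <;> simp

theorem getLast?_cut {α : Type} (s t r : List α) (v : α) :
    (s ++ v :: r).getLast? = (s ++ v :: (t ++ v :: r)).getLast? := by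
  simp [List.getLast?_append, List.getLast?_cons]

theorem two_le_length_of_ends_ne {α : Type} {p : List α} {a b : α} (hab : a ≠ b)
    (ha : p.head? = some a) (hb : p.getLast? = some b) : 2 ≤ p.length := by
  match p with
  | [] => simp at ha
  | [x] =>
    simp only [List.head?_cons, List.getLast?_singleton, Option.some.injEq] at ha hb
    exact absurd (ha.symm.trans hb) hab
  | _ :: _ :: _ => simp

/-! ### Inducing walks -/

namespace LatDAG

variable {V L : Type} {D : LatDAG V L}

/-- A walk from `a` to `b` whose interior observed nodes are colliders on it and ancestors
of `a` or `b`. -/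
structure InducingWalk (D : LatDAG V L) (a b : V) (p : List (V ⊕ L)) : Prop where
  chain : p.IsChain D.Adj
  head : p.head? = some (Sum.inl a)
  last : p.getLast? = some (Sum.inl b)
  interior : ∀ (x : V ⊕ L) (v : V) (y : V ⊕ L), ListTriple p x (Sum.inl v) y →
    (D.edge x (Sum.inl v) ∧ D.edge y (Sum.inl v)) ∧
      (D.Anc (Sum.inl v) (Sum.inl a) ∨ D.Anc (Sum.inl v) (Sum.inl b))

theorem InducingPath.inducingWalk {a b : V} {p : List (V ⊕ L)} (h : D.InducingPath a b p) :
    D.InducingWalk a b p :=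
  ⟨h.1.1.2.2, h.1.2.1, h.1.2.2, fun x v y ht => h.2 x _ y ht v rfl⟩

theorem InducingPath.ne {a b : V} {p : List (V ⊕ L)} (h : D.InducingPath a b p) : a ≠ b := by
  rintro rfl
  obtain ⟨⟨⟨hl, hn, -⟩, hh, ht⟩, -⟩ := h
  match p with
  | x :: y :: t =>
    simp only [List.head?_cons, Option.some.injEq] at hh
    subst hh
    rw [List.getLast?_cons_cons] at ht
    exact (List.nodup_cons.1 hn).1 (List.mem_of_getLast? ht)

theorem InducingWalk.reverse {a b : V} {p : List (V ⊕ L)} (h : D.InducingWalk a b p) :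
    D.InducingWalk b a p.reverse where
  chain := List.isChain_reverse.2 (h.chain.imp fun _ _ hxy => hxy.symm)
  head := by rw [List.head?_reverse, h.last]
  last := by rw [List.getLast?_reverse, h.head]
  interior x v y ht := by
    have ht' := ht.reverse
    rw [List.reverse_reverse] at ht'
    obtain ⟨⟨h₁, h₂⟩, h₃⟩ := h.interior _ _ _ ht'
    exact ⟨⟨h₂, h₁⟩, h₃.symm⟩

theorem InducingWalk.exists_inducingPath {a b : V} (hab : a ≠ b) {p : List (V ⊕ L)}
    (h : D.InducingWalk a b p) : ∃ q, D.InducingPath a b q := by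
  induction hn : p.length using Nat.strong_induction_on generalizing p with
  | _ n ih =>
    by_cases hp : p.Nodup
    · refine ⟨p, ⟨⟨two_le_length_of_ends_ne (fun hh => hab (Sum.inl_injective hh)) h.head h.last,
        hp, h.chain⟩, h.head, h.last⟩, ?_⟩
      rintro x _ y ht v rfl
      exact h.interior x v y ht
    · obtain ⟨s, v, t, r, rfl⟩ := exists_loop_of_not_nodup hp
      refine ih (s ++ v :: r).length ?_ (p := s ++ v :: r) ⟨isChain_cut h.chain, ?_, ?_, ?_⟩ rfl
      · rw [← hn]
        simp
      · rw [head?_cut s t, h.head]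
      · rw [getLast?_cut s t, h.last]
      · intro x w y ht
        rcases ht.of_cut (t := t) with ht | ⟨rfl, ⟨_, _, _, h₁⟩, _, h₂⟩
        · exact h.interior _ _ _ ht
        · exact ⟨⟨(h.interior _ _ _ h₁).1.1, (h.interior _ _ _ h₂).1.2⟩, (h.interior _ _ _ h₁).2⟩

/-- Every edge of the walk `p` at its first node points into it. -/
def StartsInto (D : LatDAG V L) (p : List (V ⊕ L)) : Prop :=
  ∀ x y t, p = x :: y :: t → D.edge y x

/-- Inducing walks meeting at a common collider `b`, an ancestor of `a` or `c`, can be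
concatenated, and the concatenation starts like the first walk. -/
theorem InducingWalk.trans {a b c : V} (hab : a ≠ b) (hbc : b ≠ c) {p q : List (V ⊕ L)}
    (hp : D.InducingWalk a b p) (hq : D.InducingWalk b c q)
    (hpb : D.StartsInto p.reverse) (hqb : D.StartsInto q)
    (hb : D.Anc (Sum.inl b) (Sum.inl a) ∨ D.Anc (Sum.inl b) (Sum.inl c)) :
    ∃ w, D.InducingWalk a c w ∧ (D.StartsInto p → D.StartsInto w) ∧
      (D.StartsInto q.reverse → D.StartsInto w.reverse) := by
  obtain ⟨s, rfl⟩ := List.getLast?_eq_some_iff.1 hp.last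
  obtain ⟨r, rfl⟩ := List.head?_eq_some_iff.1 hq.head
  have hs : s ≠ [] := by
    rintro rfl
    have := hp.head
    simp only [List.nil_append, List.head?_cons, Option.some.injEq, Sum.inl.injEq] at this
    exact hab this.symm
  have hr : r ≠ [] := by
    rintro rfl
    have := hq.last
    simp only [List.getLast?_singleton, Option.some.injEq, Sum.inl.injEq] at this
    exact hbc this
  refine ⟨s ++ Sum.inl b :: r, ⟨List.isChain_split.2 ⟨hp.chain, hq.chain⟩, ?_, ?_, ?_⟩, ?_, ?_⟩
  · rw [← hp.head]
    cases s <;> simp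
  · rw [← hq.last]
    simp [List.getLast?_append, List.getLast?_cons]
  · intro x v y ht
    rcases ht.append_cons with ht | ht | ⟨hv, ⟨s', rfl⟩, r', rfl⟩
    · obtain ⟨h₁, h₂ | h₂⟩ := hp.interior _ _ _ ht
      · exact ⟨h₁, Or.inl h₂⟩
      · exact ⟨h₁, hb.imp h₂.trans h₂.trans⟩
    · obtain ⟨h₁, h₂ | h₂⟩ := hq.interior _ _ _ ht
      · exact ⟨h₁, hb.imp h₂.trans h₂.trans⟩
      · exact ⟨h₁, Or.inr h₂⟩
    · obtain rfl := Sum.inl_injective hv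
      exact ⟨⟨hpb _ _ s'.reverse (by simp), hqb _ _ _ rfl⟩, hb⟩
  · intro h x y t he
    match s, hs with
    | [z], _ => exact h x y [] (by simp_all)
    | z :: z' :: s, _ => exact h x y (s ++ [Sum.inl b]) (by simp_all)
  · intro h x y t he
    rcases r.eq_nil_or_concat with rfl | ⟨r', z, rfl⟩
    · exact absurd rfl hr
    rcases r'.eq_nil_or_concat with rfl | ⟨r', z', rfl⟩
    · exact h x y [] (by simp_all)
    · exact h x y (r'.reverse ++ [Sum.inl b]) (by simp_all)

/-- An inducing walk from a non-ancestor of its last node points into its first node. -/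
theorem InducingWalk.startsInto (hac : ∀ x, ¬ Relation.TransGen D.edge x x)
    (hlat : ∀ x l, ¬ D.edge x (Sum.inr l)) {a b : V} {p : List (V ⊕ L)}
    (h : D.InducingWalk a b p) (hn : ¬ D.Anc (Sum.inl a) (Sum.inl b)) : D.StartsInto p := by
  rintro x y t rfl
  have hx : x = Sum.inl a := by simpa using h.head
  subst hx
  rcases (List.isChain_cons_cons.1 h.chain).1 with he | he
  · exfalso
    rcases y with v | l
    · match t with
      | [] =>
        have hv : v = b := by simpa using h.last
        exact hn (hv ▸ Relation.ReflTransGen.single he)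
      | z :: t =>
        rcases (h.interior _ v z (listTriple_iff_infix.2 ⟨[], t, rfl⟩)).2 with h' | h'
        · exact hac _ (Relation.TransGen.head' he h')
        · exact hn (Relation.ReflTransGen.head he h')
    · exact hlat _ _ he
  · exact he

theorem anc_of_restrict {A : Set V} {x y : V ⊕ L} (h : (D.restrict A).Anc x y) : D.Anc x y :=
  Relation.ReflTransGen.mono (fun _ _ h => h.1) _ _ h

theorem InducingWalk.of_restrict {A : Set V} {a b : V} {p : List (V ⊕ L)}
    (h : (D.restrict A).InducingWalk a b p) : D.InducingWalk a b p where
  chain := h.chain.imp fun _ _ hxy => hxy.imp And.left And.left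
  head := h.head
  last := h.last
  interior x v y ht :=
    let ⟨⟨h₁, h₂⟩, h₃⟩ := h.interior x v y ht
    ⟨⟨h₁.1, h₂.1⟩, h₃.imp anc_of_restrict anc_of_restrict⟩

theorem StartsInto.of_restrict {A : Set V} {p : List (V ⊕ L)}
    (h : (D.restrict A).StartsInto p) : D.StartsInto p :=
  fun x y t hp => (h x y t hp).1

/-- The endpoints of an inducing path in `D_A` lie in `A`. -/
theorem InducingPath.mem_of_restrict {A : Set V} {a b : V} {p : List (V ⊕ L)}
    (h : (D.restrict A).InducingPath a b p) : a ∈ A := by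
  obtain ⟨⟨⟨hl, -, hc⟩, hh, -⟩, -⟩ := h
  match p with
  | x :: y :: t =>
    have hx : x = Sum.inl a := by simpa using hh
    rcases (List.isChain_cons_cons.1 hc).1 with he | he
    · exact he.2.1 a hx
    · exact he.2.2.1 a hx

end LatDAG

/-! ### MAGs of DAGs -/

namespace IsMAGof

variable {V L : Type} {M : MixedGraph V} {D : LatDAG V L}

theorem ne (h : IsMAGof M D) {a b : V} (hab : M.Adj a b) : a ≠ b :=
  ((h.1 a b).1 hab).choose_spec.ne

theorem adj_symm (h : IsMAGof M D) {a b : V} (hab : M.Adj a b) : M.Adj b a := by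
  obtain ⟨p, hp⟩ := (h.1 a b).1 hab
  exact (h.1 b a).2 (hp.inducingWalk.reverse.exists_inducingPath hp.ne.symm)

theorem edge_cases (h : IsMAGof M D) {a b : V} (hab : M.Adj a b) :
    (M.DirEdge a b ∧ D.Anc (Sum.inl a) (Sum.inl b)) ∨
      (M.DirEdge b a ∧ D.Anc (Sum.inl b) (Sum.inl a)) ∨ M.BiEdge a b := by
  by_cases h₁ : D.Anc (Sum.inl a) (Sum.inl b)
  · exact Or.inl ⟨(h.2 a b hab).1.2 h₁, h₁⟩
  · by_cases h₂ : D.Anc (Sum.inl b) (Sum.inl a)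
    · exact Or.inr (Or.inl ⟨(h.2 b a (h.adj_symm hab)).1.2 h₂, h₂⟩)
    · exact Or.inr (Or.inr ((h.2 a b hab).2.2 ⟨h₁, h₂⟩))

/-- An edge without an arrowhead at `a` is directed out of `a`. -/
theorem dirEdge_of_not_arrow (h : IsMAGof M D) {a b : V} (hab : M.Adj a b)
    (hm : M.mark b a ≠ some Mark.arrow) :
    M.DirEdge a b ∧ D.Anc (Sum.inl a) (Sum.inl b) := by
  rcases h.edge_cases hab with h' | h' | h'
  · exact h'
  · exact absurd h'.1.1 hm
  · exact absurd h'.2 hm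

theorem not_anc_of_arrow (h : IsMAGof M D) {a b : V} (hab : M.Adj a b)
    (hm : M.mark b a = some Mark.arrow) : ¬ D.Anc (Sum.inl a) (Sum.inl b) := fun h' => by
  have := ((h.2 a b hab).1.2 h').2
  rw [hm] at this
  simp at this

theorem arrow_of_not_anc (h : IsMAGof M D) {a b : V} (hab : M.Adj a b)
    (hn : ¬ D.Anc (Sum.inl a) (Sum.inl b)) : M.mark b a = some Mark.arrow := by
  by_contra hm
  exact hn (h.dirEdge_of_not_arrow hab hm).2

end IsMAGof

namespace MixedGraph

variable {V : Type} {M : MixedGraph V}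

theorem restrict_mark {A : Set V} {a b : V} (ha : a ∈ A) (hb : b ∈ A) :
    (M.restrict A).mark a b = M.mark a b := if_pos ⟨ha, hb⟩

theorem restrict_collider {A : Set V} {a b c : V} (ha : a ∈ A) (hb : b ∈ A) (hc : c ∈ A) :
    (M.restrict A).Collider a b c ↔ M.Collider a b c := by
  simp only [Collider, restrict_mark ha hb, restrict_mark hc hb]

theorem restrict_dirEdge {A : Set V} {a b : V} (ha : a ∈ A) (hb : b ∈ A) :
    (M.restrict A).DirEdge a b ↔ M.DirEdge a b := by
  simp only [DirEdge, restrict_mark ha hb, restrict_mark hb ha]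

/-- A walk starting with a directed edge is directed throughout, or it meets a collider that
its first node is an ancestor of. -/
theorem anc_or_strictAnc_last {G : MixedGraph V} {Z : Set V}
    (hG : ∀ a b, G.Adj a b → G.mark b a ≠ some Mark.arrow → G.DirEdge a b)
    {w v x : V} {t : List V} (hc : (v :: x :: t).IsChain G.Adj) (hvx : G.DirEdge v x)
    (hw : (x :: t).getLast? = some w)
    (hcol : ∀ a b c, ListTriple (v :: x :: t) a b c → G.Collider a b c → ∃ z ∈ Z, G.Anc b z) :
    (∃ z ∈ Z, G.Anc v z) ∨ G.StrictAnc v w := by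
  induction t generalizing v x with
  | nil =>
    have hx : x = w := by simpa using hw
    exact Or.inr (hx ▸ Relation.TransGen.single hvx)
  | cons y t ih =>
    have hc' := (List.isChain_cons_cons.1 hc).2
    by_cases hm : G.mark y x = some Mark.arrow
    · obtain ⟨z, hz, hxz⟩ := hcol v x y (listTriple_iff_infix.2 ⟨[], t, rfl⟩) ⟨hvx.1, hm⟩
      exact Or.inl ⟨z, hz, Relation.ReflTransGen.head hvx hxz⟩
    · rcases ih hc' (hG x y (List.isChain_cons_cons.1 hc').1 hm)
          (by rwa [List.getLast?_cons_cons] at hw)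
          (fun a b c ht => hcol a b c (ht.of_infix ⟨[v], [], by simp⟩)) with ⟨z, hz, h⟩ | h
      · exact Or.inl ⟨z, hz, Relation.ReflTransGen.head hvx h⟩
      · exact Or.inr (Relation.TransGen.head hvx h)

end MixedGraph

/-! ### Shortening walks -/

/-- Distinct nodes of `A` joined by an inducing walk that points into each endpoint in `Z`. -/
def ZLink {V L : Type} (D : LatDAG V L) (A Z : Set V) (a b : V) : Prop :=
  a ≠ b ∧ a ∈ A ∧ b ∈ A ∧ ∃ p, D.InducingWalk a b p ∧
    (a ∈ Z → D.StartsInto p) ∧ (b ∈ Z → D.StartsInto p.reverse)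

section Shorten

variable {V L : Type} {D : LatDAG V L} {M : MixedGraph V} {A Z : Set V}

theorem ZLink.symm {a b : V} (h : ZLink D A Z a b) : ZLink D A Z b a := by
  obtain ⟨hab, ha, hb, p, hp, h₁, h₂⟩ := h
  exact ⟨hab.symm, hb, ha, p.reverse, hp.reverse, h₂, by rwa [List.reverse_reverse]⟩

theorem ZLink.adj (hMD : IsMAGof M D) {a b : V} (h : ZLink D A Z a b) : M.Adj a b :=
  (hMD.1 a b).2 (h.2.2.2.choose_spec.1.exists_inducingPath h.1)

theorem ZLink.adj_restrict (hMD : IsMAGof M D) {a b : V} (h : ZLink D A Z a b) :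
    (M.restrict A).Adj a b := by
  unfold MixedGraph.Adj
  rw [MixedGraph.restrict_mark h.2.1 h.2.2.1]
  exact h.adj hMD

theorem ZLink.trans {a b c : V} (hac : a ≠ c) (hab : ZLink D A Z a b) (hbc : ZLink D A Z b c)
    (hb : b ∈ Z) (hanc : D.Anc (Sum.inl b) (Sum.inl a) ∨ D.Anc (Sum.inl b) (Sum.inl c)) :
    ZLink D A Z a c := by
  obtain ⟨hne, ha, -, p, hp, hp₁, hp₂⟩ := hab
  obtain ⟨hne', -, hc, q, hq, hq₁, hq₂⟩ := hbc
  obtain ⟨w, hw, hw₁, hw₂⟩ := hp.trans hne hne' hq (hp₂ hb) (hq₁ hb) hanc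
  exact ⟨hac, ha, hc, w, hw, fun h => hw₁ (hp₁ h), fun h => hw₂ (hq₂ h)⟩

/-- The colliders of `p` in `G` are ancestors of `Z`. -/
def CollidersAnc {V : Type} (G : MixedGraph V) (Z : Set V) (p : List V) : Prop :=
  ∀ a b c, ListTriple p a b c → G.Collider a b c → ∃ z ∈ Z, G.Anc b z

theorem restrict_dirEdge_of_not_arrow (hMD : IsMAGof M D) (a b : V)
    (hab : (M.restrict A).Adj a b) (hm : (M.restrict A).mark b a ≠ some Mark.arrow) :
    (M.restrict A).DirEdge a b := by
  have hA : a ∈ A ∧ b ∈ A := by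
    by_contra hA
    simp [MixedGraph.Adj, MixedGraph.restrict, hA] at hab
  unfold MixedGraph.Adj at hab
  rw [MixedGraph.restrict_mark hA.1 hA.2] at hab
  rw [MixedGraph.restrict_mark hA.2 hA.1] at hm
  exact (MixedGraph.restrict_dirEdge hA.1 hA.2).2 (hMD.dirEdge_of_not_arrow hab hm).1

theorem restrict_not_strictAnc_self (hM : M.Ancestral) (a : V) :
    ¬ (M.restrict A).StrictAnc a a := fun h => by
  refine hM.1 a (Relation.TransGen.mono (fun x y hxy => ?_) _ _ h)
  have hA : x ∈ A ∧ y ∈ A := by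
    by_contra hA
    simp [MixedGraph.DirEdge, MixedGraph.restrict, hA] at hxy
  exact (MixedGraph.restrict_dirEdge hA.1 hA.2).1 hxy

/-- Cutting out a loop keeps the colliders ancestors of `Z`. -/
theorem CollidersAnc.cut (hMD : IsMAGof M D) (hM : M.Ancestral) {s t r : List V} {v : V}
    (hc : (s ++ v :: (t ++ v :: r)).IsChain (M.restrict A).Adj)
    (h : CollidersAnc (M.restrict A) Z (s ++ v :: (t ++ v :: r))) :
    CollidersAnc (M.restrict A) Z (s ++ v :: r) := by
  intro a b c ht hcol
  rcases ht.of_cut (t := t) with ht | ⟨rfl, ⟨x, t', hx, h₁⟩, -⟩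
  · exact h a b c ht hcol
  · have hinf : b :: x :: t' <:+: s ++ b :: (t ++ b :: r) := ⟨s, r, by simp [← hx]⟩
    have hc' := hc.infix hinf
    by_cases hm : (M.restrict A).mark x b = some Mark.arrow
    · exact h a b x h₁ ⟨hcol.1, hm⟩
    · refine (MixedGraph.anc_or_strictAnc_last (restrict_dirEdge_of_not_arrow hMD) hc'
        (restrict_dirEdge_of_not_arrow hMD b x (List.isChain_cons_cons.1 hc').1 hm)
        (w := b) (by simp [← hx]) fun a b c ht => h a b c (ht.of_infix hinf)).resolve_right
        (restrict_not_strictAnc_self hM b)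

/-- Bypassing a node of `Z` with a directed edge to its successor keeps the colliders
ancestors of `Z`. -/
theorem CollidersAnc.bypass {G : MixedGraph V} {s t : List V} {a b c : V}
    (hG : ∀ a b, G.Adj a b → G.mark b a ≠ some Mark.arrow → G.DirEdge a b)
    (hab : G.Adj a b) (hb : b ∈ Z) (hbc : G.DirEdge b c)
    (h : CollidersAnc G Z (s ++ a :: b :: c :: t)) : CollidersAnc G Z (s ++ a :: c :: t) := by
  intro x y z ht hcol
  rcases ht.append_cons with ht | ht | ⟨rfl, ⟨s', rfl⟩, r', hr⟩
  · exact h x y z (ht.of_infix ⟨[], b :: c :: t, by simp⟩) hcol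
  · rcases ListTriple.append_cons (s := [a]) ht with ht | ht | ⟨rfl, -, r', rfl⟩
    · obtain ⟨_, _, he⟩ := listTriple_iff_infix.1 ht
      have := congrArg List.length he
      simp at this
      omega
    · exact h x y z (ht.of_infix ⟨s ++ [a, b], [], by simp⟩) hcol
    · exact h b y z (listTriple_iff_infix.2 ⟨s ++ [a], r', by simp⟩) ⟨hbc.1, hcol.2⟩
  · by_cases hm : G.mark b y = some Mark.arrow
    · exact h x y b (listTriple_iff_infix.2 ⟨s', c :: t, by simp⟩) ⟨hcol.1, hm⟩
    · exact ⟨b, hb, Relation.ReflTransGen.single (hG y b hab hm)⟩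

theorem CollidersAnc.reverse {G : MixedGraph V} {p : List V} (h : CollidersAnc G Z p) :
    CollidersAnc G Z p.reverse := by
  intro a b c ht hcol
  have ht' := ht.reverse
  rw [List.reverse_reverse] at ht'
  exact h c b a ht' hcol.symm

/-- A chain of `ZLink`s whose colliders are ancestors of `Z` yields an m-connecting path. -/
theorem exists_mConnPath_of_zLink_chain (hMD : IsMAGof M D) (hM : M.Ancestral) {X Y : V}
    (hXY : X ≠ Y) {p : List V} (hc : p.IsChain (ZLink D A Z)) (hX : p.head? = some X)
    (hY : p.getLast? = some Y) (hcol : CollidersAnc (M.restrict A) Z p) :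
    ∃ q, (M.restrict A).MConnPath Z X Y q := by
  induction hn : p.length using Nat.strong_induction_on generalizing p with
  | _ n ih =>
    have hadj : p.IsChain (M.restrict A).Adj := hc.imp fun _ _ h => h.adj_restrict hMD
    by_cases hp : p.Nodup
    swap
    · obtain ⟨s, v, t, r, rfl⟩ := exists_loop_of_not_nodup hp
      refine ih (s ++ v :: r).length ?_ (isChain_cut hc) ?_ ?_ (hcol.cut hMD hM hadj) rfl
      · rw [← hn]
        simp
      · rw [head?_cut s t, hX]
      · rw [getLast?_cut s t, hY]
    by_cases hbad : ∃ a b c, ListTriple p a b c ∧ ¬ (M.restrict A).Collider a b c ∧ b ∈ Z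
    swap
    · refine ⟨p, ⟨⟨two_le_length_of_ends_ne hXY hX hY, hp, hadj⟩, hX, hY⟩, fun a b c ht =>
        ⟨hcol a b c ht, fun hn hb => hbad ⟨a, b, c, ht, hn, hb⟩⟩⟩
    obtain ⟨a, b, c, ht, hncol, hb⟩ := hbad
    obtain ⟨s, t, rfl⟩ := listTriple_iff_infix.1 ht
    have hac : a ≠ c := by
      rintro rfl
      simp [List.nodup_append] at hp
    obtain ⟨hc₁, hc₂⟩ := List.isChain_split.1 hc
    obtain ⟨hab, hc₂⟩ := List.isChain_cons_cons.1 hc₂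
    obtain ⟨hbc, hc₂⟩ := List.isChain_cons_cons.1 hc₂
    have hG := restrict_dirEdge_of_not_arrow (A := A) hMD
    have key : ZLink D A Z a c ∧ CollidersAnc (M.restrict A) Z (s ++ a :: c :: t) := by
      by_cases hm : (M.restrict A).mark c b = some Mark.arrow
      · have hm' : (M.restrict A).mark a b ≠ some Mark.arrow := fun h => hncol ⟨h, hm⟩
        refine ⟨hab.trans hac hbc hb (Or.inl ?_), ?_⟩
        · rw [MixedGraph.restrict_mark hab.2.1 hab.2.2.1] at hm'
          exact (hMD.dirEdge_of_not_arrow (hab.symm.adj hMD) hm').2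
        · have hrev : CollidersAnc (M.restrict A) Z
              (t.reverse ++ c :: b :: a :: s.reverse) := by
            simpa using hcol.reverse
          simpa using (hrev.bypass hG (hbc.symm.adj_restrict hMD) hb
            (hG b a (hab.symm.adj_restrict hMD) hm')).reverse
      · refine ⟨hab.trans hac hbc hb (Or.inr ?_), hcol.bypass hG (hab.adj_restrict hMD) hb
          (hG b c (hbc.adj_restrict hMD) hm)⟩
        rw [MixedGraph.restrict_mark hbc.2.2.1 hbc.2.1] at hm
        exact (hMD.dirEdge_of_not_arrow (hbc.adj hMD) hm).2
    refine ih (s ++ a :: c :: t).length ?_ (List.isChain_split.2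
      ⟨hc₁, List.isChain_cons_cons.2 ⟨key.1, hc₂⟩⟩) ?_ ?_ key.2 rfl
    · rw [← hn]
      simp
    · rw [← hX]
      cases s <;> simp
    · rw [← hY]
      simp [List.getLast?_append, List.getLast?_cons]

end Shorten

/-! ### From the MAG of `D_A` to the induced subgraph of the MAG -/

section Transfer

variable {V L : Type} {D : LatDAG V L} {M Mstar : MixedGraph V} {A : Set V}

theorem IsMAGof.mem_of_adj_restrict (hMs : IsMAGof Mstar (D.restrict A)) {a b : V}
    (hab : Mstar.Adj a b) : a ∈ A ∧ b ∈ A :=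
  ⟨((hMs.1 a b).1 hab).choose_spec.mem_of_restrict,
    ((hMs.1 b a).1 (hMs.adj_symm hab)).choose_spec.mem_of_restrict⟩

theorem IsMAGof.adj_of_adj_restrict (hMD : IsMAGof M D) (hMs : IsMAGof Mstar (D.restrict A))
    {a b : V} (hab : Mstar.Adj a b) : M.Adj a b := by
  obtain ⟨p, hp⟩ := (hMs.1 a b).1 hab
  exact (hMD.1 a b).2 (hp.inducingWalk.of_restrict.exists_inducingPath hp.ne)

theorem IsMAGof.anc_restrict (hMD : IsMAGof M D) (hMs : IsMAGof Mstar (D.restrict A))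
    {a b : V} (h : Mstar.Anc a b) : (M.restrict A).Anc a b := by
  refine Relation.ReflTransGen.mono (fun x y hxy => ?_) _ _ h
  have hadj : Mstar.Adj x y := by simp [MixedGraph.Adj, hxy.1]
  obtain ⟨hx, hy⟩ := hMs.mem_of_adj_restrict hadj
  exact (MixedGraph.restrict_dirEdge hx hy).2 (((hMD.2 x y (hMD.adj_of_adj_restrict hMs hadj)).1).2
    (LatDAG.anc_of_restrict ((hMs.2 x y hadj).1.1 hxy)))

/-- Arrowheads of `M` at edges of `Mstar` are arrowheads of `Mstar`. -/
theorem IsMAGof.arrow_of_arrow (hMD : IsMAGof M D) (hMs : IsMAGof Mstar (D.restrict A))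
    {a b : V} (hab : Mstar.Adj a b) (hm : M.mark b a = some Mark.arrow) :
    Mstar.mark b a = some Mark.arrow :=
  hMs.arrow_of_not_anc hab fun h =>
    hMD.not_anc_of_arrow (hMD.adj_of_adj_restrict hMs hab) hm (LatDAG.anc_of_restrict h)

theorem IsMAGof.zLink (hD : D.IsCausalDAG) (hMs : IsMAGof Mstar (D.restrict A)) {Z : Set V}
    {a b : V} (hab : Mstar.Adj a b) (ha : a ∈ Z → Mstar.mark b a = some Mark.arrow)
    (hb : b ∈ Z → Mstar.mark a b = some Mark.arrow) : ZLink D A Z a b := by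
  obtain ⟨p, hp⟩ := (hMs.1 a b).1 hab
  have hw := hp.inducingWalk
  have hac : ∀ x, ¬ Relation.TransGen (D.restrict A).edge x x := fun x hx =>
    hD.1 x (Relation.TransGen.mono (fun _ _ h => h.1) _ _ hx)
  have hlat : ∀ x l, ¬ (D.restrict A).edge x (Sum.inr l) := fun x l h => hD.2.1 x l h.1
  exact ⟨hp.ne, (hMs.mem_of_adj_restrict hab).1, (hMs.mem_of_adj_restrict hab).2, p,
    hw.of_restrict,
    fun h => (hw.startsInto hac hlat (hMs.not_anc_of_arrow hab (ha h))).of_restrict,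
    fun h => (hw.reverse.startsInto hac hlat
      (hMs.not_anc_of_arrow (hMs.adj_symm hab) (hb h))).of_restrict⟩

end Transfer

/-- **Lemma connpathsubmag.** Let `M*` be the MAG of `D_A`. An
m-connecting path between `X` and `Y` given `Z` in `M*` yields an m-connecting path
between `X` and `Y` given `Z` in `M_A`. -/
theorem mconn_magOfSubDag_to_subMag {V L : Type} (D : LatDAG V L) (hD : D.IsCausalDAG)
    (M : MixedGraph V) (hM : M.IsMAG) (hMD : IsMAGof M D)
    (A : Set V) (Mstar : MixedGraph V) (hMs : IsMAGof Mstar (D.restrict A))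
    (X Y : V) (hX : X ∈ A) (hY : Y ∈ A)
    (Z : Set V) (hZ : Z ⊆ A \ {X, Y})
    (hconn : ∃ p : List V, Mstar.MConnPath Z X Y p) :
    ∃ q : List V, (M.restrict A).MConnPath Z X Y q := by
  obtain ⟨p, ⟨⟨hlen, hnd, hch⟩, hhead, hlast⟩, htr⟩ := hconn
  have hXY : X ≠ Y := by
    rintro rfl
    match p with
    | x :: y :: t =>
      have hx : x = X := by simpa using hhead
      rw [List.getLast?_cons_cons] at hlast
      exact (List.nodup_cons.1 hnd).1 (hx ▸ List.mem_of_getLast? hlast)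
  have hcollider : ∀ a b c, ListTriple p a b c → b ∈ Z → Mstar.Collider a b c :=
    fun a b c ht hb => by_contra fun h => (htr a b c ht).2 h hb
  refine exists_mConnPath_of_zLink_chain hMD hM.2.2.1 hXY (p := p) ?_ hhead hlast ?_
  · refine List.isChain_iff_forall_rel_of_append_cons_cons.2 fun a b s t he => ?_
    have hab : Mstar.Adj a b :=
      List.isChain_iff_forall_rel_of_append_cons_cons.1 hch he
    refine hMs.zLink hD hab (fun ha => ?_) fun hb => ?_
    · rcases s.eq_nil_or_concat with rfl | ⟨s, x, rfl⟩
      · have hx : a = X := by simpa [he] using hhead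
        exact absurd (Or.inl hx) (hZ ha).2
      · exact (hcollider x a b (listTriple_iff_infix.2 ⟨s, t, by simp [he]⟩) ha).2
    · cases t with
      | nil =>
        have hy : b = Y := by simpa [he] using hlast
        exact absurd (Or.inr hy) (hZ hb).2
      | cons y t => exact (hcollider a b y (listTriple_iff_infix.2 ⟨s, t, he⟩) hb).1
  · intro a b c ht hcol
    obtain ⟨s, t, he⟩ := listTriple_iff_infix.1 ht
    have hab : Mstar.Adj a b := List.isChain_iff_forall_rel_of_append_cons_cons.1 hch he
    have hbc : Mstar.Adj b c :=
      List.isChain_iff_forall_rel_of_append_cons_cons.1 hch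
        (show p = (s ++ [a]) ++ b :: c :: t by simp [he])
    obtain ⟨ha, hb⟩ := hMs.mem_of_adj_restrict hab
    have hcol' := (MixedGraph.restrict_collider ha hb (hMs.mem_of_adj_restrict hbc).2).1 hcol
    obtain ⟨z, hz, hbz⟩ := (htr a b c ht).1
      ⟨hMD.arrow_of_arrow hMs (hMs.adj_symm hab) hcol'.1, hMD.arrow_of_arrow hMs hbc hcol'.2⟩
    exact ⟨z, hz, hMD.anc_restrict hMs hbz⟩

end CG
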